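/- Quantifier-free stability of bounded balls in free products: if G and H are qf-stable groups, then every quantifier-free formula in the language of groups with parameters in G ∗ H is stable relative to (G ∗ H, B_r(G ∗ H)) for every r ≥ 1; that is, there is a finite bound on the length of order-property configurations witnessed by tuples from the ball of radius r. -/

import Mathlib

open Monoid

/-- Quantifier-free formulas in the language of groups over a variable set `V`:
Boolean combinations of word equations `w = 1` with `w` a group word in `V`. -/
inductive QFFormula (V : Type*) where
  | eq : FreeGroup V → QFFormula V
  | not : QFFormula V → QFFormula V
  | or : QFFormula V → QFFormula V → QFFormula V

/-- Satisfaction of a quantifier-free formula in a group `K` under the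
assignment `ρ` of the variables. -/
def QFFormula.Sat {V : Type*} {K : Type*} [Group K] (ρ : V → K) :
    QFFormula V → Prop
  | .eq w => FreeGroup.lift ρ w = 1
  | .not φ => ¬ QFFormula.Sat ρ φ
  | .or φ ψ => QFFormula.Sat ρ φ ∨ QFFormula.Sat ρ ψ

/-- The ball of radius `r` in `G ∗ H`: elements whose normal form has length at
most `r`, equivalently products of at most `r` letters from `G` or `H`. -/
def coprodBall (G H : Type*) [Group G] [Group H] (r : ℕ) : Set (Coprod G H) :=
  {x | ∃ l : List (Coprod G H), l.length ≤ r ∧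
    (∀ y ∈ l, (∃ g : G, y = Coprod.inl g) ∨ (∃ h : H, y = Coprod.inr h)) ∧
    x = l.prod}

/-- A group `G` is qf-stable if every group-word equation `w(x̄, ȳ) = 1` defines a
stable relation on tuples from `G`. -/
def QFStable (G : Type*) [Group G] : Prop :=
  ∀ (p q : ℕ) (w : FreeGroup (Fin p ⊕ Fin q)), ∃ n : ℕ, ∀ m : ℕ,
    (∃ (a : Fin m → Fin p → G) (b : Fin m → Fin q → G),
      ∀ i j, FreeGroup.lift (Sum.elim (a i) (b j)) w = 1 ↔ i ≤ j) → m ≤ n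

/-- Any list of length at least some `N` (depending on `k` and `l`) has a sublist of length `k`
on which `P` holds pairwise, or one of length `l` on which `P` fails pairwise. -/
theorem exists_sublist_pairwise_or_pairwise_not {α : Type*} (P : α → α → Prop) (k l : ℕ) :
    ∃ N : ℕ, ∀ L : List α, N ≤ L.length →
      (∃ L' : List α, L'.Sublist L ∧ L'.length = k ∧ L'.Pairwise P) ∨
      (∃ L' : List α, L'.Sublist L ∧ L'.length = l ∧ L'.Pairwise fun x y => ¬ P x y) := by
  classical
  induction k generalizing l with
  | zero => exact ⟨0, fun L _ => Or.inl ⟨[], by simp⟩⟩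
  | succ k ihk =>
    induction l with
    | zero => exact ⟨0, fun L _ => Or.inr ⟨[], by simp⟩⟩
    | succ l ihl =>
      obtain ⟨N₁, h₁⟩ := ihk (l + 1)
      obtain ⟨N₂, h₂⟩ := ihl
      refine ⟨N₁ + N₂ + 1, fun L hL => ?_⟩
      match L, hL with
      | x :: L, hL =>
        have hlen : L.length = (L.filter fun y => P x y).length +
            (L.filter fun y => ¬ P x y).length := by
          have := List.length_eq_length_filter_add (l := L) (fun y => decide (P x y))
          simpa using this
        simp only [List.length_cons] at hL
        by_cases hN : N₁ ≤ (L.filter fun y => P x y).length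
        · rcases h₁ _ hN with ⟨L', hs, hl, hp⟩ | ⟨L', hs, hl, hp⟩
          · refine Or.inl ⟨x :: L', (hs.trans List.filter_sublist).cons_cons x, by simp [hl], ?_⟩
            refine List.pairwise_cons.2 ⟨fun y hy => ?_, hp⟩
            simpa using (List.mem_filter.1 (hs.subset hy)).2
          · exact Or.inr ⟨L', (hs.trans List.filter_sublist).cons x, hl, hp⟩
        · have hN' : N₂ ≤ (L.filter fun y => ¬ P x y).length := by omega
          rcases h₂ _ hN' with ⟨L', hs, hl, hp⟩ | ⟨L', hs, hl, hp⟩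
          · exact Or.inl ⟨L', (hs.trans List.filter_sublist).cons x, hl, hp⟩
          · refine Or.inr ⟨x :: L', (hs.trans List.filter_sublist).cons_cons x, by simp [hl], ?_⟩
            refine List.pairwise_cons.2 ⟨fun y hy => ?_, hp⟩
            simpa using (List.mem_filter.1 (hs.subset hy)).2

/-- A relation is stable if the lengths of its order-property configurations are bounded. -/
def StableRel {A B : Type*} (R : A → B → Prop) : Prop :=
  ∃ n : ℕ, ∀ m : ℕ, (∃ (a : Fin m → A) (b : Fin m → B), ∀ i j, R (a i) (b j) ↔ i ≤ j) → m ≤ n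

namespace StableRel

variable {A B : Type*} {R S : A → B → Prop}

theorem congr (hR : StableRel R) (h : ∀ a b, R a b ↔ S a b) : StableRel S := by
  obtain rfl : R = S := by ext a b; exact h a b
  exact hR

theorem comp {A' B' : Type*} (hR : StableRel R) (f : A' → A) (g : B' → B) :
    StableRel fun a b => R (f a) (g b) := by
  obtain ⟨n, hn⟩ := hR
  exact ⟨n, fun m ⟨a, b, h⟩ => hn m ⟨f ∘ a, g ∘ b, h⟩⟩

theorem const (A B : Type*) (P : Prop) : StableRel fun (_ : A) (_ : B) => P := by
  refine ⟨1, fun m ⟨_, _, h⟩ => ?_⟩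
  by_contra! hm
  have h₁ := h ⟨0, by omega⟩ ⟨1, hm⟩
  have h₂ := h ⟨1, hm⟩ ⟨0, by omega⟩
  simpa using h₂.1 (h₁.2 (by simp))

theorem not (hR : StableRel R) : StableRel fun a b => ¬ R a b := by
  obtain ⟨n, hn⟩ := hR
  refine ⟨n + 1, fun m ⟨a, b, h⟩ => ?_⟩
  rcases m with _ | m
  · omega
  refine Nat.succ_le_succ (hn m ⟨fun i => a i.rev.succ, fun j => b j.rev.castSucc, fun i j => ?_⟩)
  refine not_iff_not.1 ((h _ _).trans ?_)
  simp only [Fin.le_def, Fin.val_succ, Fin.val_castSucc, Fin.val_rev]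
  omega

/-- A pairwise `P`-homogeneous subsequence of an ordered configuration of length `2 * k`
gives an order-property configuration of length `k`. -/
theorem exists_ladder_of_pairwise {m k : ℕ} {a : Fin m → A} {b : Fin m → B}
    (hle : ∀ i j, R (a i) (b j) → i ≤ j) {L : List (Fin m)}
    (hL : L.length = 2 * k) (hlt : L.Pairwise (· < ·))
    (hR : L.Pairwise fun i j => R (a i) (b j)) :
    ∃ (a' : Fin k → A) (b' : Fin k → B), ∀ i j, R (a' i) (b' j) ↔ i ≤ j := by
  refine ⟨fun i => a (L[2 * i.1]'(by omega)), fun j => b (L[2 * j.1 + 1]'(by omega)),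
    fun i j => ⟨fun h => ?_, fun h => ?_⟩⟩
  · by_contra! hij
    have := List.pairwise_iff_getElem.1 hlt (2 * j.1 + 1) (2 * i.1) (by omega) (by omega)
      (by rw [Fin.lt_def] at hij; omega)
    exact absurd (hle _ _ h) (not_le.2 this)
  · exact List.pairwise_iff_getElem.1 hR _ _ (by omega) (by omega)
      (by rw [Fin.le_def] at h; omega)

theorem or (hR : StableRel R) (hS : StableRel S) : StableRel fun a b => R a b ∨ S a b := by
  obtain ⟨k, hk⟩ := hR
  obtain ⟨l, hl⟩ := hS
  obtain ⟨N, hN⟩ := exists_sublist_pairwise_or_pairwise_not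
    (fun x y : A × B => R x.1 y.2) (2 * (k + 1)) (2 * (l + 1))
  refine ⟨N, fun m ⟨a, b, h⟩ => ?_⟩
  by_contra! hm
  have hlt : (List.finRange m).Pairwise (· < ·) := List.pairwise_lt_finRange m
  rcases hN ((List.finRange m).map fun i => (a i, b i)) (by simpa using hm.le) with
    ⟨L', hs, hlen, hp⟩ | ⟨L', hs, hlen, hp⟩
  · obtain ⟨L, hL, rfl⟩ := List.sublist_map_iff.1 hs
    rw [List.pairwise_map] at hp
    have := hk _ (exists_ladder_of_pairwise (fun i j hij => (h i j).1 (Or.inl hij))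
      (by simpa using hlen) (hlt.sublist hL) hp)
    omega
  · obtain ⟨L, hL, rfl⟩ := List.sublist_map_iff.1 hs
    rw [List.pairwise_map] at hp
    have hp' : L.Pairwise fun i j => S (a i) (b j) :=
      (hp.and (hlt.sublist hL)).imp fun hij => ((h _ _).2 hij.2.le).resolve_left hij.1
    have := hl _ (exists_ladder_of_pairwise (fun i j hij => (h i j).1 (Or.inr hij))
      (by simpa using hlen) (hlt.sublist hL) hp')
    omega

theorem and (hR : StableRel R) (hS : StableRel S) : StableRel fun a b => R a b ∧ S a b :=
  (hR.not.or hS.not).not.congr fun a b => by tauto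

theorem exists_mem_finset {ι : Type*} {R : ι → A → B → Prop} (s : Finset ι)
    (hR : ∀ i, StableRel (R i)) : StableRel fun a b => ∃ i ∈ s, R i a b := by
  classical
  induction s using Finset.induction_on with
  | empty => exact (const A B False).congr fun a b => by simp
  | insert i s _ ih => exact ((hR i).or ih).congr fun a b => by simp

end StableRel

theorem QFStable.of_injective {G K : Type*} [Group G] [Group K] (hG : QFStable G)
    (f : K →* G) (hf : Function.Injective f) : QFStable K := by
  intro p q w
  obtain ⟨n, hn⟩ := hG p q w
  refine ⟨n, fun m ⟨a, b, h⟩ => hn m ⟨fun i => f ∘ a i, fun j => f ∘ b j, fun i j => ?_⟩⟩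
  rw [← h, ← map_eq_one_iff f hf, ← Sum.comp_elim]
  exact iff_of_eq (congrArg (· = 1)
    (DFunLike.congr_fun (FreeGroup.ext_hom (f := FreeGroup.lift (f ∘ Sum.elim (a i) (b j)))
      (g := f.comp (FreeGroup.lift (Sum.elim (a i) (b j)))) (by simp)) w))

theorem QFStable.stableRel {G X Y : Type*} [Group G] [Finite X] [Finite Y] (hG : QFStable G)
    (w : FreeGroup (X ⊕ Y)) :
    StableRel fun (a : X → G) (b : Y → G) => FreeGroup.lift (Sum.elim a b) w = 1 := by
  obtain ⟨p, ⟨e⟩⟩ := Finite.exists_equiv_fin X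
  obtain ⟨q, ⟨e'⟩⟩ := Finite.exists_equiv_fin Y
  have h : StableRel fun (a : Fin p → G) (b : Fin q → G) =>
      FreeGroup.lift (Sum.elim a b) (FreeGroup.map (Sum.map e e') w) = 1 :=
    hG p q _
  refine (h.comp (fun a => a ∘ e.symm) fun b => b ∘ e'.symm).congr fun a b => ?_
  refine iff_of_eq (congrArg (· = 1) (DFunLike.congr_fun (FreeGroup.ext_hom
    (f := (FreeGroup.lift _).comp (FreeGroup.map (Sum.map e e'))) (g := FreeGroup.lift _) ?_) w))
  rintro (x | y) <;> simp

theorem QFFormula.sat_map {V K L : Type*} [Group K] [Group L] (f : K →* L)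
    (hf : Function.Injective f) (ρ : V → K) (φ : QFFormula V) :
    φ.Sat (fun v => f (ρ v)) ↔ φ.Sat ρ := by
  induction φ with
  | eq w =>
    simp only [QFFormula.Sat]
    rw [← map_eq_one_iff f hf]
    exact iff_of_eq (congrArg (· = 1)
      (DFunLike.congr_fun (FreeGroup.ext_hom (f := FreeGroup.lift fun v => f (ρ v))
        (g := f.comp (FreeGroup.lift ρ)) (by simp)) w))
  | not φ ih => simp only [QFFormula.Sat, ih]
  | or φ ψ ih₁ ih₂ => simp only [QFFormula.Sat, ih₁, ih₂]

/-- In a free product, a nonempty alternating product equal to `1` has a trivial syllable. -/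
theorem Monoid.CoprodI.exists_eq_one_of_prod_eq_one {ι : Type*} {M : ι → Type*}
    [∀ i, Monoid (M i)] {l : List (Σ i, M i)} (hl : l ≠ [])
    (hc : l.IsChain fun x y => x.1 ≠ y.1)
    (h : (l.map fun x => CoprodI.of x.2).prod = 1) : ∃ x ∈ l, x.2 = 1 := by
  classical
  by_contra! hne
  let w : CoprodI.Word M := ⟨l, hne, hc⟩
  have hw : w = CoprodI.Word.empty :=
    CoprodI.Word.equiv.symm.injective (h.trans CoprodI.Word.prod_empty.symm)
  exact hl (congrArg CoprodI.Word.toList hw)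

section Syllables

variable {ι X Y : Type*} {M : ι → Type*} [∀ i, Group (M i)]

/-- The value in the free product of a list of syllables, each of which is a group word
in the variables of one factor. -/
def syllableEval (L : List (ι × FreeGroup (X ⊕ Y))) (a : ∀ i, X → M i) (b : ∀ i, Y → M i) :
    CoprodI M :=
  (L.map fun x => CoprodI.of (FreeGroup.lift (Sum.elim (a x.1) (b x.1)) x.2)).prod

theorem syllableEval_append (L L' : List (ι × FreeGroup (X ⊕ Y))) (a : ∀ i, X → M i)
    (b : ∀ i, Y → M i) :
    syllableEval (L ++ L') a b = syllableEval L a b * syllableEval L' a b := by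
  simp [syllableEval]

theorem syllableEval_cons (x : ι × FreeGroup (X ⊕ Y)) (L : List (ι × FreeGroup (X ⊕ Y)))
    (a : ∀ i, X → M i) (b : ∀ i, Y → M i) :
    syllableEval (x :: L) a b =
      CoprodI.of (FreeGroup.lift (Sum.elim (a x.1) (b x.1)) x.2) * syllableEval L a b := by
  simp [syllableEval]

theorem syllableEval_nil (a : ∀ i, X → M i) (b : ∀ i, Y → M i) :
    syllableEval ([] : List (ι × FreeGroup (X ⊕ Y))) a b = 1 := rfl

theorem exists_syllableEval_eq_inv (L : List (ι × FreeGroup (X ⊕ Y))) :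
    ∃ L' : List (ι × FreeGroup (X ⊕ Y)), ∀ (a : ∀ i, X → M i) (b : ∀ i, Y → M i),
      syllableEval L' a b = (syllableEval L a b)⁻¹ := by
  induction L with
  | nil => exact ⟨[], fun a b => by simp [syllableEval_nil]⟩
  | cons x L ih =>
    obtain ⟨L', h⟩ := ih
    refine ⟨L' ++ [(x.1, x.2⁻¹)], fun a b => ?_⟩
    simp [syllableEval_append, syllableEval_cons, syllableEval_nil, h]

theorem exists_syllableEval_eq_lift {V : Type*}
    {ρ : (∀ i, X → M i) → (∀ i, Y → M i) → V → CoprodI M}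
    (hρ : ∀ v, ∃ L : List (ι × FreeGroup (X ⊕ Y)), ∀ a b, ρ a b v = syllableEval L a b)
    (w : FreeGroup V) :
    ∃ L : List (ι × FreeGroup (X ⊕ Y)), ∀ a b,
      FreeGroup.lift (ρ a b) w = syllableEval L a b := by
  induction w using FreeGroup.induction_on with
  | C1 => exact ⟨[], fun a b => by simp [syllableEval_nil]⟩
  | of v => simpa using hρ v
  | inv_of v h =>
    obtain ⟨L, hL⟩ := h
    obtain ⟨L', hL'⟩ := exists_syllableEval_eq_inv (M := M) L
    exact ⟨L', fun a b => by rw [hL', map_inv, ← hL]⟩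
  | mul u v hu hv =>
    obtain ⟨L, hL⟩ := hu
    obtain ⟨L', hL'⟩ := hv
    exact ⟨L ++ L', fun a b => by rw [syllableEval_append, map_mul, hL, hL']⟩

/-- An alternating nonempty syllable list evaluates to `1` exactly when some syllable
is trivial and the list without it still evaluates to `1`. -/
theorem syllableEval_eq_one_iff {L : List (ι × FreeGroup (X ⊕ Y))} (hL : L ≠ [])
    (hc : L.IsChain fun x y => x.1 ≠ y.1) (a : ∀ i, X → M i) (b : ∀ i, Y → M i) :
    syllableEval L a b = 1 ↔ ∃ n ∈ (Finset.univ : Finset (Fin L.length)),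
      FreeGroup.lift (Sum.elim (a L[n].1) (b L[n].1)) L[n].2 = 1 ∧
      syllableEval (L.eraseIdx n) a b = 1 := by
  have key : ∀ n : Fin L.length,
      FreeGroup.lift (Sum.elim (a L[n].1) (b L[n].1)) L[n].2 = 1 →
      syllableEval (L.eraseIdx n) a b = syllableEval L a b := by
    intro n hn
    have hsplit : L = L.take n ++ L[n] :: L.drop (n + 1) := by simp
    rw [List.eraseIdx_eq_take_drop_succ]
    conv_rhs => rw [hsplit]
    rw [syllableEval_append, syllableEval_append, syllableEval_cons, hn, map_one, one_mul]
  constructor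
  · intro h
    let f : ι × FreeGroup (X ⊕ Y) → Σ i, M i :=
      fun x => ⟨x.1, FreeGroup.lift (Sum.elim (a x.1) (b x.1)) x.2⟩
    obtain ⟨x, hx, hx1⟩ := CoprodI.exists_eq_one_of_prod_eq_one (l := L.map f)
      (by simpa using hL) (by rwa [List.isChain_map]) (by rwa [List.map_map])
    obtain ⟨y, hy, rfl⟩ := List.mem_map.1 hx
    obtain ⟨n, hn, rfl⟩ := List.getElem_of_mem hy
    exact ⟨⟨n, hn⟩, Finset.mem_univ _, hx1, (key ⟨n, hn⟩ hx1).trans h⟩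
  · rintro ⟨n, -, hn, h⟩
    exact (key n hn).symm.trans h

theorem stableRel_syllableEval [Finite X] [Finite Y] (hM : ∀ i, QFStable (M i))
    (L : List (ι × FreeGroup (X ⊕ Y))) :
    StableRel fun (a : ∀ i, X → M i) (b : ∀ i, Y → M i) => syllableEval L a b = 1 := by
  induction hlen : L.length using Nat.strong_induction_on generalizing L with
  | _ N ih =>
  subst hlen
  by_cases hc : L.IsChain fun x y => x.1 ≠ y.1
  · by_cases hL : L = []
    · subst hL
      exact (StableRel.const _ _ True).congr fun a b => by simp [syllableEval_nil]
    · refine StableRel.congr (StableRel.exists_mem_finset Finset.univ fun n => ?_)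
        fun a b => (syllableEval_eq_one_iff hL hc a b).symm
      have hlt : (L.eraseIdx n).length < L.length := by
        rw [List.length_eraseIdx_of_lt n.2]
        have := n.2
        omega
      exact (((hM L[n].1).stableRel L[n].2).comp (fun a => a L[n].1) fun b => b L[n].1).and
        (ih _ hlt _ rfl)
  · rw [List.isChain_iff_forall_rel_of_append_cons_cons] at hc
    push Not at hc
    obtain ⟨⟨i, u⟩, ⟨j, v⟩, L₁, L₂, rfl, hij⟩ := hc
    obtain rfl : i = j := hij
    refine (ih _ ?_ (L₁ ++ (i, u * v) :: L₂) rfl).congr fun a b => ?_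
    · simp
    · simp only [syllableEval_append, syllableEval_cons, map_mul, mul_assoc]

theorem stableRel_sat {V : Type*} [Finite X] [Finite Y] (hM : ∀ i, QFStable (M i))
    {ρ : (∀ i, X → M i) → (∀ i, Y → M i) → V → CoprodI M}
    (hρ : ∀ v, ∃ L : List (ι × FreeGroup (X ⊕ Y)), ∀ a b, ρ a b v = syllableEval L a b)
    (φ : QFFormula V) : StableRel fun a b => φ.Sat (ρ a b) := by
  induction φ with
  | eq w =>
    obtain ⟨L, hL⟩ := exists_syllableEval_eq_lift hρ w
    exact (stableRel_syllableEval hM L).congr fun a b => by simp only [QFFormula.Sat, hL]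
  | not φ ih => exact ih.not
  | or φ ψ ih₁ ih₂ => exact ih₁.or ih₂

end Syllables

section Coprod

universe u v

/-- The two factors of a binary free product as a family in a common universe. -/
def coprodFactor (G : Type u) (H : Type v) : Bool → Type max u v
  | false => ULift.{v} G
  | true => ULift.{u} H

instance coprodFactor.instGroup (G : Type u) (H : Type v) [Group G] [Group H] :
    ∀ i, Group (coprodFactor G H i)
  | false => inferInstanceAs (Group (ULift.{v} G))
  | true => inferInstanceAs (Group (ULift.{u} H))

variable (G : Type u) (H : Type v) [Group G] [Group H]

/-- The inclusion of the left factor into the family of factors. -/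
def coprodFactorLeft : G ≃* coprodFactor G H false :=
  (MulEquiv.ulift : ULift.{v} G ≃* G).symm

/-- The inclusion of the right factor into the family of factors. -/
def coprodFactorRight : H ≃* coprodFactor G H true :=
  (MulEquiv.ulift : ULift.{u} H ≃* H).symm

/-- The comparison map from the binary free product to the indexed one. -/
def coprodToCoprodI : Coprod G H →* CoprodI (coprodFactor G H) :=
  Coprod.lift (CoprodI.of.comp (coprodFactorLeft G H).toMonoidHom)
    (CoprodI.of.comp (coprodFactorRight G H).toMonoidHom)

theorem coprodToCoprodI_injective : Function.Injective (coprodToCoprodI G H) := by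
  let f : ∀ i, coprodFactor G H i →* Coprod G H
    | false => Coprod.inl.comp (coprodFactorLeft G H).symm.toMonoidHom
    | true => Coprod.inr.comp (coprodFactorRight G H).symm.toMonoidHom
  have h : (CoprodI.lift f).comp (coprodToCoprodI G H) = MonoidHom.id _ := by
    ext x <;> simp [coprodToCoprodI, f]
  exact Function.LeftInverse.injective (g := CoprodI.lift f) (DFunLike.congr_fun h)

variable {G H}

theorem qfStable_coprodFactor (hG : QFStable G) (hH : QFStable H) :
    ∀ i, QFStable (coprodFactor G H i)
  | false => hG.of_injective (coprodFactorLeft G H).symm.toMonoidHom (coprodFactorLeft G H).symm.injective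
  | true => hH.of_injective (coprodFactorRight G H).symm.toMonoidHom (coprodFactorRight G H).symm.injective

/-- The product of `g false k * g true k` over `k`. -/
def alternatingProd {R : ℕ} (g : ∀ i, Fin R → coprodFactor G H i) : CoprodI (coprodFactor G H) :=
  ((List.finRange R).map fun k => CoprodI.of (g false k) * CoprodI.of (g true k)).prod

theorem exists_syllableEval_eq_alternatingProd {X Y : Type*} {R : ℕ} (x : Fin R → X ⊕ Y) :
    ∃ L : List (Bool × FreeGroup (X ⊕ Y)),
      ∀ (a : ∀ i, X → coprodFactor G H i) (b : ∀ i, Y → coprodFactor G H i),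
        alternatingProd (fun i k => Sum.elim (a i) (b i) (x k)) = syllableEval L a b := by
  unfold alternatingProd
  induction List.finRange R with
  | nil => exact ⟨[], fun a b => rfl⟩
  | cons k l ih =>
    obtain ⟨L, hL⟩ := ih
    refine ⟨(false, FreeGroup.of (x k)) :: (true, FreeGroup.of (x k)) :: L, fun a b => ?_⟩
    simp [syllableEval_cons, hL, mul_assoc]

theorem exists_alternatingProd_eq {R : ℕ} {x : Coprod G H} (hx : x ∈ coprodBall G H R) :
    ∃ g : ∀ i, Fin R → coprodFactor G H i, coprodToCoprodI G H x = alternatingProd g := by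
  obtain ⟨l, hlen, hl, rfl⟩ := hx
  induction R generalizing l with
  | zero =>
    obtain rfl : l = [] := by simpa using hlen
    exact ⟨fun _ _ => 1, by simp [alternatingProd]⟩
  | succ R ih =>
    match l, hlen, hl with
    | [], _, _ => exact ⟨fun _ _ => 1, by simp [alternatingProd]⟩
    | y :: l, hlen, hl =>
      obtain ⟨g, hg⟩ := ih l (by simpa using hlen) fun z hz => hl z (List.mem_cons_of_mem y hz)
      obtain ⟨s, hs⟩ : ∃ s : ∀ i, coprodFactor G H i,
          coprodToCoprodI G H y = CoprodI.of (s false) * CoprodI.of (s true) := by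
        rcases hl y List.mem_cons_self with ⟨z, rfl⟩ | ⟨z, rfl⟩
        · exact ⟨fun | false => coprodFactorLeft G H z | true => 1, by simp [coprodToCoprodI]⟩
        · exact ⟨fun | false => 1 | true => coprodFactorRight G H z, by simp [coprodToCoprodI]⟩
      refine ⟨fun i => Fin.cons (s i) (g i), ?_⟩
      rw [List.prod_cons, map_mul, hs, hg]
      simp [alternatingProd, List.finRange_succ, Function.comp_def]

theorem coprodBall_mono {r R : ℕ} (h : r ≤ R) : coprodBall G H r ⊆ coprodBall G H R :=
  fun _ ⟨l, hlen, hl⟩ => ⟨l, hlen.trans h, hl⟩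

theorem exists_mem_coprodBall (x : Coprod G H) : ∃ r, x ∈ coprodBall G H r := by
  induction x using Coprod.induction_on with
  | inl g => exact ⟨1, [Coprod.inl g], by simp⟩
  | inr h => exact ⟨1, [Coprod.inr h], by simp⟩
  | mul x y hx hy =>
    obtain ⟨r, l, -, hl, rfl⟩ := hx
    obtain ⟨r', l', -, hl', rfl⟩ := hy
    refine ⟨_, l ++ l', le_rfl, fun y hy => ?_, by simp⟩
    exact (List.mem_append.1 hy).elim (hl y) (hl' y)

end Coprod

/-- Quantifier-free stability of bounded balls in free products: if `G` and `H` are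
qf-stable, then every quantifier-free formula `φ(x̄, ȳ)` of the language of groups
with parameters `c` in `G ∗ H` is stable relative to `(G ∗ H, B_r(G ∗ H))` for every
`r ≥ 1`: there is a finite bound on the length of order-property configurations
witnessed by tuples from the ball of radius `r`. -/
theorem qf_stable_on_balls {G H : Type*} [Group G] [Group H]
    (hG : QFStable G) (hH : QFStable H)
    (p q s : ℕ) (φ : QFFormula ((Fin p ⊕ Fin q) ⊕ Fin s))
    (c : Fin s → Coprod G H) (r : ℕ) (hr : 1 ≤ r) :
    ∃ n : ℕ, ∀ m : ℕ,
      (∃ (a : Fin m → Fin p → Coprod G H) (b : Fin m → Fin q → Coprod G H),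
        (∀ i t, a i t ∈ coprodBall G H r) ∧ (∀ j t, b j t ∈ coprodBall G H r) ∧
        ∀ i j, φ.Sat (Sum.elim (Sum.elim (a i) (b j)) c) ↔ i ≤ j) → m ≤ n := by
  choose d hd using fun t => exists_mem_coprodBall (c t)
  let R := r + ∑ t, d t
  have hc : ∀ t, c t ∈ coprodBall G H R := fun t => coprodBall_mono
    ((Finset.single_le_sum (fun _ _ => Nat.zero_le _) (Finset.mem_univ t)).trans
      (Nat.le_add_left _ r)) (hd t)
  have hball : coprodBall G H r ⊆ coprodBall G H R := coprodBall_mono (Nat.le_add_right r _)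
  let X := (Fin p ⊕ Fin s) × Fin R
  let Y := Fin q × Fin R
  let code : (Fin p ⊕ Fin q) ⊕ Fin s → Fin R → X ⊕ Y :=
    Sum.elim (Sum.elim (fun t k => .inl (.inl t, k)) fun t k => .inr (t, k))
      fun t k => .inl (.inr t, k)
  obtain ⟨n, hn⟩ := stableRel_sat (qfStable_coprodFactor hG hH)
    (ρ := fun (a : ∀ i, X → coprodFactor G H i) (b : ∀ i, Y → coprodFactor G H i) v =>
      alternatingProd fun i k => Sum.elim (a i) (b i) (code v k))
    (fun v => exists_syllableEval_eq_alternatingProd (code v)) φ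
  refine ⟨n, fun m ⟨a, b, ha, hb, h⟩ => hn m ?_⟩
  choose a' ha' using fun i t => exists_alternatingProd_eq (hball (ha i t))
  choose b' hb' using fun j t => exists_alternatingProd_eq (hball (hb j t))
  choose c' hc' using fun t => exists_alternatingProd_eq (hc t)
  refine ⟨fun i e x => Sum.elim (fun t => a' i t e x.2) (fun t => c' t e x.2) x.1,
    fun j e y => b' j y.1 e y.2, fun i j => ?_⟩
  rw [← h, ← QFFormula.sat_map _ (coprodToCoprodI_injective G H)]
  refine iff_of_eq (congrArg (fun ρ => φ.Sat ρ) (funext ?_))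
  rintro ((t | t) | t)
  · exact (ha' i t).symm
  · exact (hb' j t).symm
  · exact (hc' t).symm
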